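/- Let f : ℝ² → ℝ be a polynomial function with f(0,0) = 0, and let r > 0 be such that f(p) > 0 for every p in the closed ball of radius r centered at the origin with p ≠ (0,0), and the gradient ∇f(p) ≠ 0 for every such p. Then there exists ε₀ > 0 such that for every ε with 0 < ε < ε₀, the level set C_ε = f⁻¹({ε}) ∩ closedBall(0, r) is homeomorphic to the unit circle S¹ = {v ∈ ℝ² : ‖v‖ = 1}. -/

import Mathlib

open Set Filter Topology Metric
open scoped NNReal

/-- A continuous function on a compact set all of whose local minimum points lie in a preconnected
subset forces the compact set to be preconnected. -/
theorem IsCompact.isPreconnected_of_isLocalMinOn_mem {X : Type*} [TopologicalSpace X]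
    {K S : Set X} {f : X → ℝ} (hK : IsCompact K) (hf : ContinuousOn f K)
    (hS : IsPreconnected S) (hSK : S ⊆ K)
    (hmin : ∀ b ∈ K, IsLocalMinOn f K b → b ∈ S) : IsPreconnected K := by
  rw [isPreconnected_closed_iff]
  intro t t' ht ht' hKt hne hne'
  by_contra hcon
  rw [not_nonempty_iff_eq_empty] at hcon
  have key : ∀ u u' : Set X, IsClosed u → IsClosed u' → K ⊆ u ∪ u' → (K ∩ u').Nonempty →
      K ∩ (u ∩ u') = ∅ → ¬ S ⊆ u := by
    intro u u' hu hu' hKu hne hcon hSu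
    obtain ⟨b, hb, hbmin⟩ := (hK.inter_right hu').exists_isMinOn hne (hf.mono inter_subset_left)
    have hbu : b ∉ u := fun h ↦ (hcon ▸ (⟨hb.1, h, hb.2⟩ : b ∈ K ∩ (u ∩ u')) : b ∈ (∅ : Set X))
    refine hbu (hSu (hmin b hb.1 ?_))
    filter_upwards [self_mem_nhdsWithin, nhdsWithin_le_nhds (hu.isOpen_compl.mem_nhds hbu)]
      with q hq hqu
    exact hbmin ⟨hq, (hKu hq).resolve_left hqu⟩
  rcases isPreconnected_iff_subset_of_disjoint_closed.1 hS t t' ht ht' (hSK.trans hKt)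
    (subset_empty_iff.1 (hcon ▸ inter_subset_inter_left _ hSK)) with h | h
  · exact key t t' ht ht' hKt hne' hcon h
  · exact key t' t ht' ht (union_comm t t' ▸ hKt) hne (inter_comm t t' ▸ hcon) h

/-- Two real functions agreeing modulo `1` on a preconnected set differ there by a constant
integer. -/
theorem IsPreconnected.exists_int_add_of_coe_eq {X : Type*} [TopologicalSpace X]
    {D : Set X} (hD : IsPreconnected D) {f g : X → ℝ} (hf : ContinuousOn f D)
    (hg : ContinuousOn g D) (h : ∀ x ∈ D, (f x : AddCircle (1 : ℝ)) = g x) :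
    ∃ n : ℤ, ∀ x ∈ D, f x = g x + n := by
  rcases D.eq_empty_or_nonempty with rfl | ⟨x₀, hx₀⟩
  · simp
  have hint : ∀ x ∈ D, ∃ n : ℤ, f x - g x = n := by
    intro x hx
    have h1 : ((f x - g x : ℝ) : AddCircle (1 : ℝ)) = 0 := by
      rw [AddCircle.coe_sub, h x hx, sub_self]
    obtain ⟨n, hn⟩ := (AddCircle.coe_eq_zero_iff (1 : ℝ)).1 h1
    exact ⟨n, by simpa using hn.symm⟩
  obtain ⟨n, hn⟩ := hint x₀ hx₀
  refine ⟨n, fun x hx ↦ ?_⟩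
  have hc : ((fun x ↦ f x - g x) '' D).Subsingleton :=
    (countable_range ((↑) : ℤ → ℝ)).isTotallyDisconnected _
      (image_subset_iff.2 fun z hz ↦ (hint z hz).imp fun _ h ↦ h.symm)
      (hD.image _ (hf.sub hg))
  have := hc ⟨x, hx, rfl⟩ ⟨x₀, hx₀, rfl⟩
  simp only at this
  linarith

/-- Simply connected spaces are unicoherent. -/
theorem IsPreconnected.inter_of_union_eq_univ {X : Type*} [TopologicalSpace X] [NormalSpace X]
    [SimplyConnectedSpace X] [LocallyPathConnectedSpace X] {D E : Set X}
    (hD : IsPreconnected D) (hE : IsPreconnected E) (hDc : IsClosed D) (hEc : IsClosed E)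
    (hDE : D ∪ E = univ) : IsPreconnected (D ∩ E) := by
  classical
  rw [isPreconnected_iff_subset_of_disjoint_closed]
  intro a b ha hb hab hemp
  by_contra! hcon
  obtain ⟨⟨y, hy, hya⟩, ⟨x, hx, hxb⟩⟩ := And.imp not_subset.1 not_subset.1 hcon
  have hxa := (hab hx).resolve_right hxb
  have hyb := (hab hy).resolve_left hya
  obtain ⟨u, hu0, hu1, -⟩ := exists_continuous_zero_one_of_isClosed
    ((hDc.inter hEc).inter ha) ((hDc.inter hEc).inter hb) (by
      rw [disjoint_iff_inter_eq_empty, ← hemp]; ext; simp; tauto)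
  let g : X → AddCircle (1 : ℝ) := fun x ↦
    if x ∈ D then ((u x / 2 : ℝ) : AddCircle (1 : ℝ)) else ((-(u x / 2) : ℝ) : AddCircle (1 : ℝ))
  have hgD : ∀ z ∈ D, g z = ((u z / 2 : ℝ) : AddCircle (1 : ℝ)) := fun z hz ↦ if_pos hz
  have hgE : ∀ z ∈ E, g z = ((-(u z / 2) : ℝ) : AddCircle (1 : ℝ)) := by
    intro z hz
    by_cases hzD : z ∈ D
    · rw [hgD z hzD]
      rcases hab ⟨hzD, hz⟩ with h | h
      · simp [hu0 ⟨⟨hzD, hz⟩, h⟩]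
      · rw [hu1 ⟨⟨hzD, hz⟩, h⟩, ← sub_eq_zero, ← AddCircle.coe_sub, AddCircle.coe_eq_zero_iff]
        exact ⟨1, by norm_num⟩
    · exact if_neg hzD
  have hq : Continuous ((↑) : ℝ → AddCircle (1 : ℝ)) := AddCircle.continuous_mk' 1
  have hg : Continuous g := by
    rw [← continuousOn_univ, ← hDE]
    refine ContinuousOn.union_of_isClosed ?_ ?_ hDc hEc
    · exact (hq.comp (by fun_prop : Continuous fun z ↦ u z / 2)).continuousOn.congr hgD
    · exact (hq.comp (by fun_prop : Continuous fun z ↦ -(u z / 2))).continuousOn.congr hgE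
  obtain ⟨e₀, he₀⟩ := QuotientAddGroup.mk_surjective (g x)
  obtain ⟨F, ⟨-, hF⟩, -⟩ := (AddCircle.isCoveringMap_coe (1 : ℝ)).existsUnique_continuousMap_lifts
    ⟨g, hg⟩ x e₀ he₀
  have hF' : ∀ z, (F z : AddCircle (1 : ℝ)) = g z := fun z ↦ congrFun hF z
  obtain ⟨m, hm⟩ := hD.exists_int_add_of_coe_eq F.continuous.continuousOn
    (by fun_prop : ContinuousOn (fun z ↦ u z / 2) D) (fun z hz ↦ by rw [hF', hgD z hz])
  obtain ⟨n, hn⟩ := hE.exists_int_add_of_coe_eq F.continuous.continuousOn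
    (by fun_prop : ContinuousOn (fun z ↦ -(u z / 2)) E) (fun z hz ↦ by rw [hF', hgE z hz])
  have h1 := hm x hx.1
  have h2 := hn x hx.2
  have h3 := hm y hy.1
  have h4 := hn y hy.2
  simp only [hu0 ⟨hx, hxa⟩, hu1 ⟨hy, hyb⟩, Pi.zero_apply, Pi.one_apply] at h1 h2 h3 h4
  have h5 : (m : ℝ) = n := by linarith
  linarith

/-- A one-parameter group acting on a compact connected space with open, nonconstant orbit maps
exhibits the space as a circle. -/
theorem nonempty_homeomorph_circle_of_addAction {C : Type*} [TopologicalSpace C] [CompactSpace C]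
    [T2Space C] [ConnectedSpace C] [AddAction ℝ C]
    (hcont : ∀ x : C, Continuous fun t : ℝ ↦ t +ᵥ x) (hopen : ∀ x : C, IsOpenMap fun t : ℝ ↦ t +ᵥ x)
    (hne : ∀ x : C, ∃ t : ℝ, t +ᵥ x ≠ x) : Nonempty (C ≃ₜ Circle) := by
  obtain ⟨x⟩ := (inferInstance : Nonempty C)
  have horb : ∀ y : C, IsOpen (AddAction.orbit ℝ y) := fun y ↦ (hopen y).isOpen_range
  have hsurj : AddAction.orbit ℝ x = univ := by
    refine IsClopen.eq_univ ⟨⟨?_⟩, horb x⟩ (AddAction.nonempty_orbit x)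
    rw [isOpen_iff_mem_nhds]
    intro y hy
    filter_upwards [(horb y).mem_nhds (AddAction.mem_orbit_self y)] with z hz hzx
    exact hy (AddAction.orbit_eq_iff.1
      ((AddAction.orbit_eq_iff.2 hz).symm.trans (AddAction.orbit_eq_iff.2 hzx)))
  have hiff : ∀ s t : ℝ, s +ᵥ x = t +ᵥ x ↔ -s + t ∈ AddAction.stabilizer ℝ x := by
    intro s t
    rw [AddAction.mem_stabilizer_iff, add_vadd, neg_vadd_eq_iff, eq_comm]
  have hclosed : IsClosed (AddAction.stabilizer ℝ x : Set ℝ) :=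
    isClosed_eq (hcont x) continuous_const
  have hmap : ∃ T : ℝ, AddAction.stabilizer ℝ x = AddSubgroup.zmultiples T := by
    rcases AddSubgroup.dense_or_cyclic (AddAction.stabilizer ℝ x) with h | ⟨T, hT⟩
    · obtain ⟨t, ht⟩ := hne x
      exact absurd (hclosed.closure_eq ▸ h t : t ∈ (AddAction.stabilizer ℝ x : Set ℝ)) ht
    · exact ⟨T, by rw [hT, AddSubgroup.zmultiples_eq_closure]⟩
  obtain ⟨T, hT⟩ := hmap
  let φ : AddCircle T → C := Quotient.lift (fun t : ℝ ↦ t +ᵥ x) (by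
    intro s t hst
    rw [hiff, hT]
    exact QuotientAddGroup.leftRel_apply.1 hst)
  have hφ : ∀ t : ℝ, φ (t : AddCircle T) = t +ᵥ x := fun t ↦ rfl
  have hφc : Continuous φ := (hcont x).quotient_lift _
  have hφo : IsOpenMap φ := by
    intro U hU
    have := hopen x _ (hU.preimage (AddCircle.continuous_mk' T))
    convert this using 1
    ext y
    constructor
    · rintro ⟨z, hz, rfl⟩
      obtain ⟨t, rfl⟩ := QuotientAddGroup.mk_surjective z
      exact ⟨t, hz, rfl⟩
    · rintro ⟨t, ht, rfl⟩
      exact ⟨t, ht, rfl⟩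
  have hφi : Function.Injective φ := by
    intro a b hab
    obtain ⟨s, rfl⟩ := QuotientAddGroup.mk_surjective a
    obtain ⟨t, rfl⟩ := QuotientAddGroup.mk_surjective b
    have := (hiff s t).1 hab
    rw [hT] at this
    exact QuotientAddGroup.eq.2 this
  have hφs : Function.Surjective φ := by
    intro y
    obtain ⟨t, ht⟩ : y ∈ AddAction.orbit ℝ x := hsurj ▸ mem_univ y
    exact ⟨t, ht⟩
  let e : AddCircle T ≃ₜ C := (Equiv.ofBijective φ ⟨hφi, hφs⟩).toHomeomorphOfContinuousOpen hφc hφo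
  have hT0 : T ≠ 0 := by
    rintro rfl
    have hinj : Function.Injective fun t : ℝ ↦ t +ᵥ x := by
      intro s t hst
      have := (hiff s t).1 hst
      rw [hT, AddSubgroup.zmultiples_zero_eq_bot, AddSubgroup.mem_bot] at this
      linarith
    have hemb := IsOpenEmbedding.of_continuous_injective_isOpenMap (hcont x) hinj (hopen x)
    have : IsClosedEmbedding fun t : ℝ ↦ t +ᵥ x :=
      ⟨hemb.isEmbedding, by
        have : range (fun t : ℝ ↦ t +ᵥ x) = univ := hsurj
        rw [this]; exact isClosed_univ⟩
    have := this.compactSpace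
    exact not_compactSpace_iff.2 (inferInstance : NoncompactSpace ℝ) this
  exact ⟨e.symm.trans (AddCircle.homeomorphCircle hT0)⟩

/-- A bounded Lipschitz vector field has a global integral curve through every point. -/
theorem LipschitzWith.exists_forall_hasDerivAt {E : Type*} [NormedAddCommGroup E]
    [NormedSpace ℝ E] [CompleteSpace E] {v : E → E} {K L : ℝ≥0} (hv : LipschitzWith K v)
    (hL : ∀ x, ‖v x‖ ≤ L) (x : E) :
    ∃ γ : ℝ → E, γ 0 = x ∧ ∀ t, HasDerivAt γ (v (γ t)) t := by
  have hloc : ∀ a : ℝ, 0 < a → ∃ γ : ℝ → E,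
      γ 0 = x ∧ ∀ t ∈ Ioo (-a) a, HasDerivAt γ (v (γ t)) t := by
    intro a ha
    have hpl : IsPicardLindelof (fun _ ↦ v) (tmin := -a) (tmax := a) ⟨0, by simp [ha.le]⟩ x
        (L * ⟨a, ha.le⟩) 0 L K :=
      .of_time_independent (fun y _ ↦ hL y) hv.lipschitzOnWith (by
          simp only [sub_zero, zero_sub, neg_neg, max_self, NNReal.coe_zero]
          exact le_rfl)
    obtain ⟨γ, h0, hγ⟩ := hpl.exists_eq_forall_mem_Icc_hasDerivWithinAt₀
    exact ⟨γ, h0, fun t ht ↦ (hγ t (Ioo_subset_Icc_self ht)).hasDerivAt (Icc_mem_nhds ht.1 ht.2)⟩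
  choose! γ hγ0 hγ using hloc
  have heq : ∀ a b : ℝ, 0 < a → a ≤ b → EqOn (γ a) (γ b) (Ioo (-a) a) := by
    intro a b ha hab
    exact ODE_solution_unique_of_mem_Ioo (v := fun _ ↦ v) (s := fun _ ↦ univ) (K := K) (t₀ := 0)
      (fun _ _ ↦ hv.lipschitzOnWith) ⟨by linarith, ha⟩ (fun t ht ↦ ⟨hγ a ha t ht, mem_univ _⟩)
      (fun t ht ↦ ⟨hγ b (ha.trans_le hab) t ⟨by linarith [ht.1], by linarith [ht.2]⟩, mem_univ _⟩)
      (by rw [hγ0 a ha, hγ0 b (ha.trans_le hab)])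
  refine ⟨fun t ↦ γ (|t| + 1) t, hγ0 _ (by positivity), fun t ↦ ?_⟩
  have ht : t ∈ Ioo (-(|t| + 1)) (|t| + 1) := abs_lt.1 (lt_add_one _)
  refine (hγ _ (by positivity) t ht).congr_of_eventuallyEq ?_
  filter_upwards [isOpen_Ioo.mem_nhds ht] with s hs
  rcases le_total (|s| + 1) (|t| + 1) with h | h
  · exact heq _ _ (by positivity) h (abs_lt.1 (lt_add_one _))
  · exact (heq _ _ (by positivity) h hs).symm

theorem MvPolynomial.contDiff_eval {σ : Type*} [Fintype σ] {n : WithTop ℕ∞} (F : MvPolynomial σ ℝ) :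
    ContDiff ℝ n fun x : σ → ℝ ↦ MvPolynomial.eval x F := by
  induction F using MvPolynomial.induction_on with
  | C a => simpa using contDiff_const
  | add p q hp hq => simpa using hp.add hq
  | mul_X p i hp => simpa using hp.mul (contDiff_apply ℝ ℝ i)

/-- The Hamiltonian vector of a covector on the Euclidean plane: the representing vector turned by
a right angle. -/
noncomputable def hamiltonianVector (l : EuclideanSpace ℝ (Fin 2) →L[ℝ] ℝ) :
    EuclideanSpace ℝ (Fin 2) :=
  !₂[-l (EuclideanSpace.single 1 1), l (EuclideanSpace.single 0 1)]

theorem EuclideanSpace.apply_eq_fin_two (l : EuclideanSpace ℝ (Fin 2) →L[ℝ] ℝ)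
    (w : EuclideanSpace ℝ (Fin 2)) :
    l w = w 0 * l (EuclideanSpace.single 0 1) + w 1 * l (EuclideanSpace.single 1 1) := by
  have hw : w = w 0 • EuclideanSpace.single 0 (1 : ℝ) + w 1 • EuclideanSpace.single 1 (1 : ℝ) := by
    ext i; fin_cases i <;> simp
  conv_lhs => rw [hw]
  simp

theorem apply_hamiltonianVector (l : EuclideanSpace ℝ (Fin 2) →L[ℝ] ℝ) :
    l (hamiltonianVector l) = 0 := by
  rw [EuclideanSpace.apply_eq_fin_two]
  simp [hamiltonianVector]
  ring

theorem sq_apply_add_sq_inner_hamiltonianVector (l : EuclideanSpace ℝ (Fin 2) →L[ℝ] ℝ)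
    (w : EuclideanSpace ℝ (Fin 2)) :
    l w ^ 2 + inner ℝ (hamiltonianVector l) w ^ 2 = ‖hamiltonianVector l‖ ^ 2 * ‖w‖ ^ 2 := by
  rw [EuclideanSpace.apply_eq_fin_two l w, EuclideanSpace.real_norm_sq_eq,
    EuclideanSpace.real_norm_sq_eq]
  simp [hamiltonianVector, PiLp.inner_apply]
  ring

theorem hamiltonianVector_ne_zero {l : EuclideanSpace ℝ (Fin 2) →L[ℝ] ℝ} (hl : l ≠ 0) :
    hamiltonianVector l ≠ 0 := by
  intro h
  refine hl (ContinuousLinearMap.ext fun w ↦ ?_)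
  simpa [h] using sq_apply_add_sq_inner_hamiltonianVector l w

theorem contDiff_hamiltonianVector {n : WithTop ℕ∞} : ContDiff ℝ n hamiltonianVector := by
  rw [contDiff_euclidean]
  intro i
  fin_cases i
  · simpa [hamiltonianVector] using (contDiff_id.clm_apply contDiff_const).neg
  · simpa [hamiltonianVector] using contDiff_id.clm_apply contDiff_const

/-- Near a regular point, a level set in the plane is covered by any curve in it with Hamiltonian
velocity. -/
theorem eventually_mem_image_of_hamiltonianVector
    {f : EuclideanSpace ℝ (Fin 2) → ℝ} {l : EuclideanSpace ℝ (Fin 2) →L[ℝ] ℝ}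
    {γ : ℝ → EuclideanSpace ℝ (Fin 2)} {t₀ : ℝ} (hf : HasStrictFDerivAt f l (γ t₀)) (hl : l ≠ 0)
    (hγ : HasStrictDerivAt γ (hamiltonianVector l) t₀) (hfγ : ∀ t, f (γ t) = f (γ t₀))
    {U : Set ℝ} (hU : U ∈ 𝓝 t₀) :
    ∀ᶠ q in 𝓝 (γ t₀), f q = f (γ t₀) → q ∈ γ '' U := by
  set V := hamiltonianVector l with hV
  have hV0 : 0 < ‖V‖ := norm_pos_iff.2 (hamiltonianVector_ne_zero hl)
  obtain ⟨s, hs, hfs⟩ := hf.approximates_deriv_on_nhds (c := ‖V‖₊ / 2)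
    (Or.inr (by rw [← NNReal.coe_pos]; simpa using hV0))
  have hinj : ∀ x ∈ s, ∀ y ∈ s, f x = f y → inner ℝ V x = inner ℝ V y → x = y := by
    intro x hx y hy hxy hVxy
    have h1 := hfs x hx y hy
    have h2 := sq_apply_add_sq_inner_hamiltonianVector l (x - y)
    rw [← hV, inner_sub_right, hVxy, sub_self] at h2
    rw [hxy, sub_self, zero_sub, norm_neg, Real.norm_eq_abs] at h1
    simp only [NNReal.coe_div, coe_nnnorm, NNReal.coe_ofNat] at h1
    have h3 : l (x - y) ^ 2 ≤ (‖V‖ / 2 * ‖x - y‖) ^ 2 := by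
      rw [← sq_abs]; gcongr
    have h4 : ‖V‖ * ‖x - y‖ = 0 := by nlinarith [sq_nonneg (‖V‖ * ‖x - y‖)]
    exact sub_eq_zero.1 (norm_eq_zero.1 ((mul_eq_zero.1 h4).resolve_left hV0.ne'))
  have hh : HasStrictDerivAt (fun t ↦ inner ℝ V (γ t)) (inner ℝ V V) t₀ :=
    (innerSL ℝ V).hasStrictFDerivAt.comp_hasStrictDerivAt t₀ hγ
  have hmem : (fun t ↦ inner ℝ V (γ t)) '' (U ∩ γ ⁻¹' s) ∈ 𝓝 (inner ℝ V (γ t₀)) := by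
    rw [← hh.map_nhds_eq (by rw [real_inner_self_eq_norm_sq]; positivity)]
    exact image_mem_map (inter_mem hU (hγ.hasDerivAt.continuousAt.preimage_mem_nhds hs))
  have hc : ContinuousAt (fun q ↦ inner ℝ V q) (γ t₀) := by fun_prop
  filter_upwards [hs, hc.preimage_mem_nhds hmem] with q hqs hq hfq
  obtain ⟨t, ⟨htU, hts⟩, ht⟩ := hq
  exact ⟨t, htU, hinj _ hts _ hqs ((hfγ t).trans hfq.symm) ht⟩

/-- A compact connected regular level set of a `C²` function on a disc that avoids the boundary
circle is a circle. -/
theorem nonempty_homeomorph_circle_levelSet {f : EuclideanSpace ℝ (Fin 2) → ℝ}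
    (hf : ContDiff ℝ 2 f) {r ε : ℝ} (hr : 0 < r)
    (hsph : ∀ q ∈ sphere (0 : EuclideanSpace ℝ (Fin 2)) r, f q ≠ ε)
    (hreg : ∀ q ∈ f ⁻¹' {ε} ∩ closedBall 0 r, fderiv ℝ f q ≠ 0)
    (hconn : IsConnected (f ⁻¹' {ε} ∩ closedBall 0 r)) :
    Nonempty (↥(f ⁻¹' {ε} ∩ closedBall 0 r) ≃ₜ Circle) := by
  set C := f ⁻¹' {ε} ∩ closedBall 0 r with hC
  let χ : ContDiffBump (0 : EuclideanSpace ℝ (Fin 2)) := ⟨r, r + 1, hr, by linarith⟩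
  let v : EuclideanSpace ℝ (Fin 2) → EuclideanSpace ℝ (Fin 2) :=
    fun q ↦ χ q • hamiltonianVector (fderiv ℝ f q)
  have hv1 : ContDiff ℝ 1 v := χ.contDiff.smul
    (contDiff_hamiltonianVector.comp (hf.fderiv_right (m := 1) (by norm_num)))
  have hvs : HasCompactSupport v := χ.hasCompactSupport.smul_right
  obtain ⟨K, hK⟩ := hv1.lipschitzWith_of_hasCompactSupport hvs one_ne_zero
  obtain ⟨L, hL⟩ := hvs.exists_bound_of_continuous hv1.continuous
  have hvC : ∀ q ∈ C, v q = hamiltonianVector (fderiv ℝ f q) := fun q hq ↦ by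
    simp only [v, χ.one_of_mem_closedBall hq.2, one_smul]
  have hfl : ∀ x, ∃ γ : ℝ → EuclideanSpace ℝ (Fin 2),
      γ 0 = x ∧ ∀ t, HasDerivAt γ (v (γ t)) t :=
    hK.exists_forall_hasDerivAt (L := L.toNNReal) fun x ↦ (hL x).trans L.le_coe_toNNReal
  choose φ hφ0 hφ using hfl
  have hφadd : ∀ x s t, φ x (s + t) = φ (φ x t) s := by
    intro x s t
    refine congrFun (ODE_solution_unique_univ (v := fun _ ↦ v) (s := fun _ ↦ univ) (K := K)
      (f := fun s ↦ φ x (s + t)) (g := φ (φ x t)) (t₀ := 0) (fun _ ↦ hK.lipschitzOnWith)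
      (fun s ↦ ⟨(hφ x (s + t)).comp_add_const s t, mem_univ _⟩)
      (fun s ↦ ⟨hφ _ s, mem_univ _⟩) ?_) s
    simp [hφ0]
  have hφc : ∀ x, Continuous (φ x) := fun x ↦
    continuous_iff_continuousAt.2 fun t ↦ (hφ x t).continuousAt
  have hfd : ∀ q, HasStrictFDerivAt f (fderiv ℝ f q) q := fun q ↦
    hf.contDiffAt.hasStrictFDerivAt (by norm_num)
  have hfφ : ∀ x t, f (φ x t) = f x := by
    intro x t
    have hd : ∀ t, HasDerivAt (fun t ↦ f (φ x t)) 0 t := by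
      intro t
      convert! (hfd (φ x t)).hasFDerivAt.comp_hasDerivAt t (hφ x t) using 1
      simp [v, apply_hamiltonianVector]
    rw [is_const_of_deriv_eq_zero (fun t ↦ (hd t).differentiableAt) (fun t ↦ (hd t).deriv) t 0,
      hφ0]
  have hφC : ∀ x ∈ C, ∀ t, φ x t ∈ C := by
    intro x hx t
    refine ⟨(hfφ x t).trans hx.1, ?_⟩
    by_contra hball
    rw [mem_closedBall_zero_iff, not_le] at hball
    have hx0 : ‖φ x 0‖ ≤ r := by rw [hφ0]; exact mem_closedBall_zero_iff.1 hx.2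
    obtain ⟨s, hs⟩ := mem_range_of_exists_le_of_exists_ge (hφc x).norm ⟨0, hx0⟩ ⟨t, hball.le⟩
    exact hsph _ (mem_sphere_zero_iff_norm.2 hs) ((hfφ x s).trans hx.1)
  have hCc : IsCompact C := (isCompact_closedBall 0 r).inter_left
    (isClosed_singleton.preimage hf.continuous)
  have := isCompact_iff_compactSpace.1 hCc
  have := isConnected_iff_connectedSpace.1 hconn
  let _ : AddAction ℝ C :=
    { vadd := fun t x ↦ ⟨φ x t, hφC x x.2 t⟩
      zero_vadd := fun x ↦ Subtype.ext (hφ0 x)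
      add_vadd := fun s t x ↦ Subtype.ext (hφadd x s t) }
  have hcoe : ∀ (t : ℝ) (x : C), ((t +ᵥ x : C) : EuclideanSpace ℝ (Fin 2)) = φ x t :=
    fun _ _ ↦ rfl
  refine nonempty_homeomorph_circle_of_addAction (fun x ↦ (hφc x).subtype_mk _) (fun x ↦ ?_)
    (fun x ↦ ?_)
  · intro U hU
    rw [isOpen_iff_mem_nhds]
    rintro _ ⟨t, ht, rfl⟩
    have hmem := hφC x x.2 t
    have hstrict : HasStrictDerivAt (φ x) (hamiltonianVector (fderiv ℝ f (φ x t))) t := by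
      rw [← hvC _ hmem]
      exact hasStrictDerivAt_of_hasDerivAt_of_continuousAt (.of_forall (hφ x))
        (hv1.continuous.comp (hφc x)).continuousAt
    have := eventually_mem_image_of_hamiltonianVector (hfd (φ x t)) (hreg _ hmem) hstrict
      (fun s ↦ by rw [hfφ, hfφ]) (hU.mem_nhds ht)
    have hcont : ContinuousAt ((↑) : C → EuclideanSpace ℝ (Fin 2)) (t +ᵥ x) :=
      continuousAt_subtype_val
    filter_upwards [hcont.eventually this] with q hq
    obtain ⟨s, hs, hsq⟩ := hq (q.2.1.trans hmem.1.symm)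
    exact ⟨s, hs, Subtype.ext hsq⟩
  · by_contra! hcon
    have hconst : φ x = fun _ ↦ (x : EuclideanSpace ℝ (Fin 2)) :=
      funext fun t ↦ congrArg Subtype.val (hcon t)
    have h0 := hφ x 0
    rw [hφ0, hvC _ x.2, hconst] at h0
    exact hamiltonianVector_ne_zero (hreg _ x.2) (h0.unique (hasDerivAt_const 0 _))

/-- The unit circle of `ℂ` is the unit circle of the Euclidean plane. -/
theorem nonempty_circle_homeomorph_sphere :
    Nonempty (Circle ≃ₜ {v : EuclideanSpace ℝ (Fin 2) | ‖v‖ = 1}) := by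
  refine ⟨Complex.orthonormalBasisOneI.repr.toHomeomorph.subtype fun z ↦ ?_⟩
  rw [← SetLike.mem_coe, Submonoid.coe_unitSphere, mem_sphere_zero_iff_norm, mem_ofPred_eq]
  exact (congrArg (· = 1) (Complex.orthonormalBasisOneI.repr.norm_map z)).symm.to_iff

/-- If a positive definite function without nonzero critical points on a disc exceeds `ε` on the
boundary circle, then its level set at height `ε` is connected. -/
theorem isConnected_levelSet {E : Type*} [NormedAddCommGroup E] [NormedSpace ℝ E]
    [FiniteDimensional ℝ E] (hE : 1 < Module.rank ℝ E) {f : E → ℝ} (hf : Continuous f)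
    {r ε : ℝ} (hr : 0 < r) (hf0 : f 0 < ε)
    (hsph : ∀ q ∈ sphere (0 : E) r, ε < f q)
    (hreg : ∀ q ∈ ball (0 : E) r, q ≠ 0 → ¬ IsLocalExtr f q) :
    IsConnected (f ⁻¹' {ε} ∩ closedBall 0 r) := by
  have h0 : (0 : E) ∈ closedBall (0 : E) r := mem_closedBall_self hr.le
  have hball : ∀ q ∈ closedBall (0 : E) r, q ∉ sphere (0 : E) r → q ∈ ball (0 : E) r :=
    fun q hq hqs ↦ lt_of_le_of_ne hq hqs
  constructor
  · have : Nontrivial E := by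
      rw [← rank_pos_iff_nontrivial (R := ℝ)]; exact zero_lt_one.trans hE
    obtain ⟨p, hp⟩ := NormedSpace.sphere_nonempty (x := (0 : E)).2 hr.le
    obtain ⟨q, hq, hqε⟩ := (convex_closedBall (0 : E) r).isPreconnected.intermediate_value h0
      (sphere_subset_closedBall hp) hf.continuousOn ⟨hf0.le, (hsph p hp).le⟩
    exact ⟨q, hqε, hq⟩
  set B := closedBall (0 : E) r
  have hBc : IsCompact B := isCompact_closedBall 0 r
  have hD : IsPreconnected (B ∩ {q | f q ≤ ε}) := by
    refine (hBc.inter_right (isClosed_le hf continuous_const)).isPreconnected_of_isLocalMinOn_mem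
      (S := {0}) hf.continuousOn isPreconnected_singleton (singleton_subset_iff.2 ⟨h0, hf0.le⟩) ?_
    intro b hb hmin
    by_contra hb0
    have hbb : b ∈ ball (0 : E) r := hball b hb.1 fun h ↦ (hsph b h).not_ge hb.2
    refine hreg b hbb hb0 (Or.inl ?_)
    filter_upwards [isOpen_ball.mem_nhds hbb, eventually_nhdsWithin_iff.1 hmin] with q hq hqmin
    by_cases hqε : f q ≤ ε
    · exact hqmin ⟨ball_subset_closedBall hq, hqε⟩
    · exact hb.2.trans (not_le.1 hqε).le
  have hU : IsPreconnected (B ∩ {q | ε ≤ f q}) := by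
    refine (hBc.inter_right (isClosed_le continuous_const hf)).isPreconnected_of_isLocalMinOn_mem
      (S := sphere 0 r) hf.neg.continuousOn (isPreconnected_sphere hE 0 r)
      (fun q hq ↦ ⟨sphere_subset_closedBall hq, (hsph q hq).le⟩) ?_
    intro b hb hmin
    by_contra hbs
    have hbb := hball b hb.1 hbs
    refine hreg b hbb (fun h ↦ (h ▸ hf0).not_ge hb.2) (Or.inr ?_)
    filter_upwards [isOpen_ball.mem_nhds hbb, eventually_nhdsWithin_iff.1 hmin] with q hq hqmin
    by_cases hqε : ε ≤ f q
    · exact neg_le_neg_iff.1 (hqmin ⟨ball_subset_closedBall hq, hqε⟩)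
    · exact (not_le.1 hqε).le.trans hb.2
  have : ContractibleSpace B := (convex_closedBall (0 : E) r).contractibleSpace ⟨0, h0⟩
  have : LocallyPathConnectedSpace B := (convex_closedBall (0 : E) r).locallyPathConnectedSpace
  have hcont : Continuous fun q : B ↦ f q := hf.comp continuous_subtype_val
  rw [← Subtype.image_preimage_coe, IsInducing.subtypeVal.isPreconnected_image] at hD hU
  have := hD.inter_of_union_eq_univ hU (isClosed_le hcont continuous_const)
    (isClosed_le continuous_const hcont) (eq_univ_of_forall fun q ↦ le_total (f q) ε)
  rw [inter_comm, ← Subtype.image_preimage_coe, IsInducing.subtypeVal.isPreconnected_image]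
  convert this using 1
  ext q
  exact le_antisymm_iff


/-- Let `f : ℝ² → ℝ` be a polynomial function with `f(0,0) = 0`, and let `r > 0`
be such that `f > 0` and `∇f ≠ 0` on the punctured closed ball of radius `r` around the origin.
Then for all sufficiently small `ε > 0`, the level set `f⁻¹({ε}) ∩ closedBall(0,r)` is
homeomorphic to the unit circle `S¹ = {v : ‖v‖ = 1}`. -/
theorem small_level_set_homeomorphic_circle (f : EuclideanSpace ℝ (Fin 2) → ℝ)
    (hpoly : ∃ F : MvPolynomial (Fin 2) ℝ,
      ∀ q : EuclideanSpace ℝ (Fin 2), f q = MvPolynomial.eval ![q 0, q 1] F)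
    (hf0 : f 0 = 0) (r : ℝ) (hr : 0 < r)
    (hpos : ∀ q ∈ Metric.closedBall (0 : EuclideanSpace ℝ (Fin 2)) r, q ≠ 0 → 0 < f q)
    (hreg : ∀ q ∈ Metric.closedBall (0 : EuclideanSpace ℝ (Fin 2)) r, q ≠ 0 →
      fderiv ℝ f q ≠ 0) :
    ∃ ε₀ > 0, ∀ ε : ℝ, 0 < ε → ε < ε₀ →
      Nonempty (↥(f ⁻¹' {ε} ∩ Metric.closedBall (0 : EuclideanSpace ℝ (Fin 2)) r) ≃ₜ
        ↥{v : EuclideanSpace ℝ (Fin 2) | ‖v‖ = 1}) := by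
  obtain ⟨F, hF⟩ := hpoly
  have hf : ContDiff ℝ 2 f := by
    have : f = fun q ↦ MvPolynomial.eval ![q 0, q 1] F := funext hF
    rw [this]
    refine F.contDiff_eval.comp (contDiff_pi.2 fun i ↦ ?_)
    fin_cases i
    · exact contDiff_piLp_apply 2 (i := (0 : Fin 2))
    · exact contDiff_piLp_apply 2 (i := (1 : Fin 2))
  have hrank : 1 < Module.rank ℝ (EuclideanSpace ℝ (Fin 2)) := by
    rw [← Module.finrank_eq_rank, finrank_euclideanSpace_fin]
    norm_num
  have hne : (sphere (0 : EuclideanSpace ℝ (Fin 2)) r).Nonempty :=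
    NormedSpace.sphere_nonempty.2 hr.le
  obtain ⟨p, hp, hpmin⟩ := (isCompact_sphere (0 : EuclideanSpace ℝ (Fin 2)) r).exists_isMinOn hne
    hf.continuous.continuousOn
  refine ⟨f p, hpos p (sphere_subset_closedBall hp) (ne_of_mem_sphere hp hr.ne'),
    fun ε hε0 hε ↦ ?_⟩
  have hsph : ∀ q ∈ sphere (0 : EuclideanSpace ℝ (Fin 2)) r, ε < f q :=
    fun q hq ↦ hε.trans_le (hpmin hq)
  have hconn := isConnected_levelSet hrank hf.continuous hr (hf0 ▸ hε0) hsph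
    fun q hq hq0 hext ↦ hreg q (ball_subset_closedBall hq) hq0 hext.fderiv_eq_zero
  obtain ⟨e⟩ := nonempty_homeomorph_circle_levelSet hf hr (fun q hq ↦ (hsph q hq).ne')
    (fun q hq ↦ hreg q hq.2 fun h ↦ hε0.ne (hf0.symm.trans (h ▸ hq.1))) hconn
  obtain ⟨e'⟩ := nonempty_circle_homeomorph_sphere
  exact ⟨e.trans e'⟩
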